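/- Let 𝒜 : ℝ^{M×N} → ℝ^{M×N} be the linear operator 𝒜(V) = Σ_{i=1}^{p} A_i V B_iᵀ with A_i ∈ ℝ^{M×M}, B_i ∈ ℝ^{N×N}, suppose A_1 = I (the M×M identity matrix), and suppose 𝒜 is self-adjoint with respect to the Frobenius inner product and satisfies γ‖V‖_F² ≤ ⟨V, 𝒜(V)⟩_F ≤ Γ‖V‖_F² for all V, where 0 < γ < Γ. Let C ∈ ℝ^{M×N} with rank(C) ≤ p and let U be the solution of 𝒜(U) = C. Then with q = (Γ−γ)/(Γ+γ), for every integer r ≥ 1: τ_r(U) ≤ (‖U‖_F / q) · (1/r)^{ln(1/q)/ln(p+1)}. -/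

import Mathlib

open Matrix

/-- Frobenius inner product of real matrices. -/
noncomputable def frobInner {M N : ℕ} (X Y : Matrix (Fin M) (Fin N) ℝ) : ℝ :=
  ∑ i, ∑ j, X i j * Y i j

/-- Frobenius norm of a real matrix. -/
noncomputable def frobNorm {M N : ℕ} (X : Matrix (Fin M) (Fin N) ℝ) : ℝ :=
  Real.sqrt (frobInner X X)

/-- Best rank-`r` approximation error in the Frobenius norm. -/
noncomputable def tau {M N : ℕ} (r : ℕ) (U : Matrix (Fin M) (Fin N) ℝ) : ℝ :=
  sInf {x : ℝ | ∃ V : Matrix (Fin M) (Fin N) ℝ, V.rank ≤ r ∧ x = frobNorm (U - V)}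

section FrobeniusInnerProduct

variable {M N : ℕ} (X Y Z : Matrix (Fin M) (Fin N) ℝ)

lemma frobInner_comm : frobInner X Y = frobInner Y X := by
  simp only [frobInner, mul_comm]

lemma frobInner_add_left : frobInner (X + Y) Z = frobInner X Z + frobInner Y Z := by
  simp only [frobInner, Matrix.add_apply, add_mul, Finset.sum_add_distrib]

lemma frobInner_smul_left (c : ℝ) : frobInner (c • X) Y = c * frobInner X Y := by
  simp only [frobInner, Matrix.smul_apply, smul_eq_mul, mul_assoc, Finset.mul_sum]

lemma frobInner_add_right : frobInner X (Y + Z) = frobInner X Y + frobInner X Z := by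
  simp only [frobInner, Matrix.add_apply, mul_add, Finset.sum_add_distrib]

lemma frobInner_smul_right (c : ℝ) : frobInner X (c • Y) = c * frobInner X Y := by
  rw [frobInner_comm, frobInner_smul_left, frobInner_comm]

lemma frobInner_self_nonneg : 0 ≤ frobInner X X :=
  Finset.sum_nonneg fun _ _ => Finset.sum_nonneg fun _ _ => mul_self_nonneg _

lemma frobNorm_nonneg : 0 ≤ frobNorm X := Real.sqrt_nonneg _

lemma frobNorm_sq : frobNorm X ^ 2 = frobInner X X :=
  Real.sq_sqrt (frobInner_self_nonneg X)

end FrobeniusInnerProduct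

/-- A self-adjoint linear operator whose quadratic form is bounded by `q` in absolute value
has operator norm at most `q`. -/
lemma frobNorm_apply_le_of_abs_frobInner_le {M N : ℕ}
    (T : Matrix (Fin M) (Fin N) ℝ →ₗ[ℝ] Matrix (Fin M) (Fin N) ℝ)
    (hT : ∀ X Y, frobInner (T X) Y = frobInner X (T Y)) {q : ℝ} (hq : 0 < q)
    (hb : ∀ X, |frobInner X (T X)| ≤ q * frobInner X X) (X : Matrix (Fin M) (Fin N) ℝ) :
    frobNorm (T X) ≤ q * frobNorm X := by
  refine le_of_sq_le_sq ?_ (mul_nonneg hq.le (frobNorm_nonneg X))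
  rw [mul_pow, frobNorm_sq, frobNorm_sq]
  have hplus := (abs_le.1 (hb (q • X + T X))).2
  have hminus := (abs_le.1 (hb (q • X + (-1 : ℝ) • T X))).1
  have hsymm : frobInner X (T (T X)) = frobInner (T X) (T X) := (hT _ _).symm
  simp only [map_add, map_smul, frobInner_add_left, frobInner_add_right, frobInner_smul_left,
    frobInner_smul_right, hsymm, frobInner_comm (T X) X] at hplus hminus
  have key : q * frobInner (T X) (T X) ≤ q * (q ^ 2 * frobInner X X) := by
    linarith
  exact le_of_mul_le_mul_left key hq

lemma Matrix.rank_add_le_add_rank {m n : Type*} [Fintype n] [Finite m] (X Y : Matrix m n ℝ) :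
    (X + Y).rank ≤ X.rank + Y.rank := by
  have hrange : LinearMap.range (X + Y).mulVecLin ≤
      LinearMap.range X.mulVecLin ⊔ LinearMap.range Y.mulVecLin := by
    rintro _ ⟨v, rfl⟩
    rw [Matrix.mulVecLin_add]
    exact Submodule.add_mem_sup ⟨v, rfl⟩ ⟨v, rfl⟩
  exact (Submodule.finrank_mono hrange).trans (Submodule.finrank_add_le_finrank_add_finrank _ _)

lemma Matrix.rank_sum_le_card_mul {m n ι : Type*} [Fintype n] [Finite m]
    (s : Finset ι) (f : ι → Matrix m n ℝ) {r : ℕ} (hf : ∀ i ∈ s, (f i).rank ≤ r) :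
    (∑ i ∈ s, f i).rank ≤ s.card * r := by
  classical
  induction s using Finset.induction_on with
  | empty => simp
  | insert a s ha ih =>
    rw [Finset.sum_insert ha, Finset.card_insert_of_notMem ha, add_mul, one_mul, add_comm]
    exact (Matrix.rank_add_le_add_rank _ _).trans (add_le_add
      (ih fun i hi => hf i (Finset.mem_insert_of_mem hi)) (hf a (Finset.mem_insert_self a s)))

/-- One Richardson step multiplies the rank by at most `p` and then adds at most `rank C`, when
the first left Kronecker factor is the identity. -/
lemma rank_richardson_step_le {M N p : ℕ} (hp : 0 < p)
    (A : Fin p → Matrix (Fin M) (Fin M) ℝ) (B : Fin p → Matrix (Fin N) (Fin N) ℝ)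
    (hA1 : A ⟨0, hp⟩ = 1) (α : ℝ) (V C : Matrix (Fin M) (Fin N) ℝ) :
    (V + (-α) • (∑ i, A i * V * (B i)ᵀ) + α • C).rank ≤ p * V.rank + C.rank := by
  have hsplit : V + (-α) • (∑ i, A i * V * (B i)ᵀ) =
      ∑ i, A i * V * ((-α) • (B i)ᵀ +
        (if i = ⟨0, hp⟩ then (1 : ℝ) else 0) • (1 : Matrix (Fin N) (Fin N) ℝ)) := by
    simp only [Matrix.mul_add, Finset.sum_add_distrib, Matrix.mul_smul, Finset.smul_sum,
      Matrix.mul_one]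
    simp only [ite_smul, one_smul, zero_smul, Finset.sum_ite_eq', Finset.mem_univ, if_true, hA1,
      Matrix.one_mul]
    exact add_comm _ _
  have hC : (α • C).rank ≤ C.rank := by
    rw [← Matrix.mul_one C, ← Matrix.mul_smul, Matrix.mul_one C]
    exact Matrix.rank_mul_le_left _ _
  rw [hsplit]
  refine (Matrix.rank_add_le_add_rank _ _).trans (add_le_add ?_ hC)
  refine (Matrix.rank_sum_le_card_mul Finset.univ _ (r := V.rank) ?_).trans (by simp)
  exact fun i _ => (Matrix.rank_mul_le_left _ _).trans (Matrix.rank_mul_le_right _ _)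

lemma tau_le_frobNorm_sub {M N r : ℕ} (U : Matrix (Fin M) (Fin N) ℝ)
    {V : Matrix (Fin M) (Fin N) ℝ} (hV : V.rank ≤ r) : tau r U ≤ frobNorm (U - V) := by
  refine csInf_le ⟨0, ?_⟩ ⟨V, hV, rfl⟩
  rintro _ ⟨W, -, rfl⟩
  exact frobNorm_nonneg _

/-- Geometric decay along powers of `b` becomes algebraic decay. -/
lemma pow_log_le_div_mul_rpow {q : ℝ} (hq : 0 < q) (hq1 : q < 1) {b r : ℕ} (hb : 1 < b)
    (hr : 1 ≤ r) :
    q ^ Nat.log b r ≤ 1 / q * ((1 : ℝ) / r) ^ (Real.log (1 / q) / Real.log b) := by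
  have hr0 : (0 : ℝ) < r := by exact_mod_cast hr
  have hb1 : (1 : ℝ) < b := by exact_mod_cast hb
  have hlogb : 0 < Real.log b := Real.log_pos hb1
  have hlog : Real.log r ≤ (Nat.log b r + 1 : ℕ) * Real.log b := by
    rw [← Real.log_pow]
    exact Real.log_le_log hr0 (by exact_mod_cast (Nat.lt_pow_succ_log_self hb r).le)
  have hpow : ((1 : ℝ) / r) ^ (Real.log (1 / q) / Real.log b) =
      q ^ (Real.log r / Real.log b) := by
    rw [Real.rpow_def_of_pos (by positivity), Real.rpow_def_of_pos hq]
    simp only [one_div, Real.log_inv]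
    congr 1
    ring
  have hle : q ^ (Nat.log b r + 1) ≤ q ^ (Real.log r / Real.log b) := by
    rw [← Real.rpow_natCast]
    exact Real.rpow_le_rpow_of_exponent_ge hq hq1.le ((div_le_iff₀ hlogb).2 hlog)
  rw [hpow, one_div, inv_mul_eq_div, le_div_iff₀ hq, ← pow_succ]
  exact hle

/-- improved singular value tail decay when one Kronecker factor
of the operator is the identity (`A_1 = I`): the rank growth factor `p + 2`
improves to `p + 1`. -/
theorem tau_decay_linear_equation_identity_factor
    {M N p : ℕ} (hp : 0 < p)
    (A : Fin p → Matrix (Fin M) (Fin M) ℝ)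
    (B : Fin p → Matrix (Fin N) (Fin N) ℝ)
    (hA1 : A ⟨0, hp⟩ = 1)
    (opA : Matrix (Fin M) (Fin N) ℝ → Matrix (Fin M) (Fin N) ℝ)
    (hopA : ∀ V, opA V = ∑ i, A i * V * (B i)ᵀ)
    (hself : ∀ X Y : Matrix (Fin M) (Fin N) ℝ, frobInner (opA X) Y = frobInner X (opA Y))
    (γ Γ : ℝ) (hγ : 0 < γ) (hγΓ : γ < Γ)
    (hlow : ∀ V : Matrix (Fin M) (Fin N) ℝ, γ * (frobNorm V) ^ 2 ≤ frobInner V (opA V))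
    (hup : ∀ V : Matrix (Fin M) (Fin N) ℝ, frobInner V (opA V) ≤ Γ * (frobNorm V) ^ 2)
    (C : Matrix (Fin M) (Fin N) ℝ) (hC : C.rank ≤ p)
    (U : Matrix (Fin M) (Fin N) ℝ) (hU : opA U = C)
    (r : ℕ) (hr : 1 ≤ r) :
    tau r U ≤ (frobNorm U / ((Γ - γ) / (Γ + γ))) *
      ((1 : ℝ) / r) ^ (Real.log (1 / ((Γ - γ) / (Γ + γ))) / Real.log ((p : ℝ) + 1)) := by
  set q : ℝ := (Γ - γ) / (Γ + γ) with hqdef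
  have hsum : 0 < Γ + γ := by linarith
  have hq : 0 < q := div_pos (by linarith) hsum
  have hq1 : q < 1 := (div_lt_one hsum).2 (by linarith)
  set α : ℝ := 2 / (Γ + γ) with hαdef
  have hα : 0 < α := div_pos two_pos hsum
  have hαγ : 1 - α * γ = q := by rw [hαdef, hqdef]; field_simp; ring
  have hαΓ : 1 - α * Γ = -q := by rw [hαdef, hqdef]; field_simp; ring
  let T : Matrix (Fin M) (Fin N) ℝ →ₗ[ℝ] Matrix (Fin M) (Fin N) ℝ :=
    { toFun := fun V => V + (-α) • opA V
      map_add' := fun X Y => by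
        simp only [hopA, Matrix.mul_add, Matrix.add_mul, Finset.sum_add_distrib, smul_add]
        abel
      map_smul' := fun c X => by
        simp only [hopA, Matrix.mul_smul, Matrix.smul_mul, ← Finset.smul_sum, smul_add,
          RingHom.id_apply, smul_comm c (-α)] }
  have hT : ∀ V, T V = V + (-α) • opA V := fun _ => rfl
  have hTle : ∀ V, frobNorm (T V) ≤ q * frobNorm V := by
    refine frobNorm_apply_le_of_abs_frobInner_le T (fun X Y => ?_) hq fun X => ?_
    · simp only [hT, frobInner_add_left, frobInner_add_right, frobInner_smul_left,
        frobInner_smul_right, hself]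
    · have h1 := mul_le_mul_of_nonneg_left (hlow X) hα.le
      have h2 := mul_le_mul_of_nonneg_left (hup X) hα.le
      rw [frobNorm_sq] at h1 h2
      simp only [hT, frobInner_add_right, frobInner_smul_right]
      rw [abs_le]
      constructor
      · rw [← neg_mul, ← hαΓ]; linarith
      · rw [← hαγ]; linarith
  have happrox : ∀ k : ℕ, ∃ V : Matrix (Fin M) (Fin N) ℝ,
      V.rank + 1 ≤ (p + 1) ^ k ∧ frobNorm (U - V) ≤ q ^ k * frobNorm U := by
    intro k
    induction k with
    | zero => exact ⟨0, by simp, by simp⟩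
    | succ k ih =>
      obtain ⟨V, hrank, herr⟩ := ih
      refine ⟨T V + α • C, ?_, ?_⟩
      · have hstep := rank_richardson_step_le hp A B hA1 α V C
        rw [← hopA, ← hT] at hstep
        have hmul := Nat.mul_le_mul_left p hrank
        rw [pow_succ]
        linarith
      · have hres : U - (T V + α • C) = T (U - V) := by
          rw [map_sub, hT U, hU, neg_smul]
          abel
        rw [hres, pow_succ', mul_assoc]
        exact (hTle _).trans (mul_le_mul_of_nonneg_left herr hq.le)
  obtain ⟨V, hrank, herr⟩ := happrox (Nat.log (p + 1) r)
  have hVr : V.rank ≤ r := by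
    have := Nat.pow_log_le_self (p + 1) (x := r) (by omega)
    omega
  have hdecay := pow_log_le_div_mul_rpow hq hq1 (b := p + 1) (by omega) hr
  push_cast at hdecay
  calc tau r U ≤ frobNorm (U - V) := tau_le_frobNorm_sub U hVr
    _ ≤ q ^ Nat.log (p + 1) r * frobNorm U := herr
    _ ≤ _ := mul_le_mul_of_nonneg_right hdecay (frobNorm_nonneg U)
    _ = _ := by ring
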